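/- (a) (S_n − n(2p−1)(X_1+X_2)/2)/√n converges in distribution, as n → ∞, to the mixture of normal laws p·N(0, 4p(1−p)) + (1−p)·N(0,1), i.e. the limit distribution function is x ↦ p·Φ_{0,4p(1−p)}(x) + (1−p)·Φ_{0,1}(x). (b) (S_n − n(2p−1)(X_1+X_2)/2)/n → 0 almost surely as n → ∞. (c) limsup_{n→∞} (S_n − n(2p−1)(X_1+X_2)/2)/√(2n log log n) = σ(X_1,X_2) and liminf_{n→∞} of the same quantity = −σ(X_1,X_2) almost surely, where σ(X_1,X_2) = 2√(p(1−p)) on the event {X_1·X_2 = 1} and σ(X_1,X_2) = 1 otherwise. -/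

import Mathlib

open MeasureTheory ProbabilityTheory Filter Topology

noncomputable section

/-- The σ-algebra generated by the steps `X 1, …, X n`. -/
def sigmaUpTo {Ω : Type*} (X : ℕ → Ω → ℝ) (n : ℕ) : MeasurableSpace Ω :=
  ⨆ i ∈ Finset.Icc 1 n, MeasurableSpace.comap (X i) inferInstance

/-- The σ-algebra generated by all the steps `X 1, X 2, …`. -/
def sigmaAll {Ω : Type*} (X : ℕ → Ω → ℝ) : MeasurableSpace Ω :=
  ⨆ i ∈ Set.Ici 1, MeasurableSpace.comap (X i) inferInstance

/-- The partial sum `X 1 + ⋯ + X n` of the walk. -/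
def partialSum {Ω : Type*} (X : ℕ → Ω → ℝ) (n : ℕ) (ω : Ω) : ℝ :=
  ∑ k ∈ Finset.Icc 1 n, X k ω

/-- Convergence in distribution of the random variables `f n` to the law `ν`,
expressed as weak convergence tested against bounded continuous functions. -/
def TendstoInDistribution {Ω : Type*} [MeasurableSpace Ω] (μ : Measure Ω)
    (f : ℕ → Ω → ℝ) (ν : Measure ℝ) : Prop :=
  ∀ g : BoundedContinuousFunction ℝ ℝ,
    Tendsto (fun n => ∫ ω, g (f n ω) ∂μ) atTop (𝓝 (∫ x, g x ∂ν))

lemma iIndep_of_indep_iSup_lt {Ω : Type*} {mΩ : MeasurableSpace Ω} {μ : Measure Ω}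
    [IsProbabilityMeasure μ] {m : ℕ → MeasurableSpace Ω}
    (h : ∀ n, Indep (⨆ i ∈ Set.Iio n, m i) (m n) μ) : iIndep m μ := by
  rw [iIndep_iff]
  intro s
  induction s using Finset.induction_on_max with
  | empty => intro f _; simp
  | insert a s has ih =>
    intro f hf
    have ha : a ∉ s := fun h' => lt_irrefl _ (has a h')
    rw [Finset.prod_insert ha, Finset.set_biInter_insert, Set.inter_comm, mul_comm,
      ← ih fun i hi => hf i (Finset.mem_insert_of_mem hi)]
    refine (Indep_iff _ _ μ).1 (h a) _ _ ?_ (hf a (Finset.mem_insert_self _ _))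
    refine Finset.measurableSet_biInter (m := ⨆ i ∈ Set.Iio a, m i) _ fun i hi => ?_
    exact (le_iSup₂_of_le i (has i hi) le_rfl : m i ≤ _) _ (hf i (Finset.mem_insert_of_mem hi))

/-- A sequence whose terms have law `κ` independently of the previous terms is i.i.d. -/
lemma iIndepFun_and_map_eq_of_inter_preimage {Ω : Type*} {mΩ : MeasurableSpace Ω} {μ : Measure Ω}
    [IsProbabilityMeasure μ] {Y : ℕ → Ω → ℝ} (hY : ∀ n, Measurable (Y n)) (κ : Measure ℝ)
    (h : ∀ n B s, MeasurableSet[⨆ i ∈ Set.Iio n, MeasurableSpace.comap (Y i) inferInstance] B →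
      MeasurableSet s → μ (B ∩ Y n ⁻¹' s) = μ B * κ s) :
    iIndepFun Y μ ∧ ∀ n, μ.map (Y n) = κ := by
  have hlaw (n : ℕ) (s : Set ℝ) (hs : MeasurableSet s) : μ (Y n ⁻¹' s) = κ s := by
    simpa using h n Set.univ s MeasurableSet.univ hs
  refine ⟨iIndep_of_indep_iSup_lt fun n => ?_, fun n => ?_⟩
  · rw [Indep_iff]
    rintro B _ hB ⟨s, hs, rfl⟩
    rw [h n B s hB hs, hlaw n s hs]
  · ext s hs
    rw [Measure.map_apply (hY n) hs, hlaw n s hs]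

/-- Bounded i.i.d. sequences with mean `0` and variance `1`. -/
structure IsBoundedStandardIID {Ω : Type*} [MeasurableSpace Ω] (μ : Measure Ω) (Z : ℕ → Ω → ℝ)
    (B : ℝ) : Prop where
  meas : ∀ n, Measurable (Z n)
  indep : iIndepFun Z μ
  ident : ∀ n, IdentDistrib (Z n) (Z 0) μ μ
  bdd : ∀ᵐ ω ∂μ, |Z 0 ω| ≤ B
  mean : ∫ ω, Z 0 ω ∂μ = 0
  var : ∫ ω, Z 0 ω ^ 2 ∂μ = 1

namespace IsBoundedStandardIID

variable {Ω : Type*} [MeasurableSpace Ω] {μ : Measure Ω}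
  {Z : ℕ → Ω → ℝ} {B : ℝ}

lemma neg (h : IsBoundedStandardIID μ Z B) : IsBoundedStandardIID μ (fun n ω => -Z n ω) B where
  meas n := (h.meas n).neg
  indep := h.indep.comp (fun _ x => -x) fun _ => measurable_neg
  ident n := (h.ident n).comp measurable_neg
  bdd := by simpa using h.bdd
  mean := by rw [integral_neg, h.mean, neg_zero]
  var := by simpa using h.var

lemma ae_bdd (h : IsBoundedStandardIID μ Z B) (n : ℕ) : ∀ᵐ ω ∂μ, |Z n ω| ≤ B :=
  (h.ident n).symm.ae_snd (p := fun x => |x| ≤ B)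
    (measurableSet_le (by fun_prop) (by fun_prop)) h.bdd

variable [IsProbabilityMeasure μ]

lemma bound_nonneg (h : IsBoundedStandardIID μ Z B) : 0 ≤ B := by
  obtain ⟨ω, hω⟩ := h.bdd.exists
  exact (abs_nonneg _).trans hω

lemma integrable_exp_mul (h : IsBoundedStandardIID μ Z B) (n : ℕ) (θ : ℝ) :
    Integrable (fun ω => Real.exp (θ * Z n ω)) μ := by
  refine Integrable.of_bound (C := Real.exp (|θ| * B)) ?_ ?_
  · have := h.meas n
    exact Measurable.aestronglyMeasurable (by fun_prop)
  · filter_upwards [h.ae_bdd n] with ω hω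
    rw [Real.norm_eq_abs, Real.abs_exp]
    refine Real.exp_le_exp.2 ((le_abs_self _).trans ?_)
    rw [abs_mul]
    gcongr

lemma integrable (h : IsBoundedStandardIID μ Z B) (n : ℕ) : Integrable (Z n) μ :=
  Integrable.of_bound (h.meas n).aestronglyMeasurable B (h.ae_bdd n)

lemma integrable_sq (h : IsBoundedStandardIID μ Z B) (n : ℕ) :
    Integrable (fun ω => Z n ω ^ 2) μ := by
  refine Integrable.of_bound ((h.meas n).pow_const 2).aestronglyMeasurable (B ^ 2) ?_
  filter_upwards [h.ae_bdd n] with ω hω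
  rw [Real.norm_eq_abs, abs_pow]
  gcongr

lemma one_le_mgf (h : IsBoundedStandardIID μ Z B) (n : ℕ) (θ : ℝ) :
    1 ≤ ∫ ω, Real.exp (θ * Z n ω) ∂μ := by
  have hm : ∫ ω, Z n ω ∂μ = 0 := by rw [(h.ident n).integral_eq, h.mean]
  calc (1 : ℝ) = ∫ ω, (θ * Z n ω + 1) ∂μ := by
        rw [integral_add ((h.integrable n).const_mul θ) (integrable_const _), integral_const_mul,
          hm]
        simp
    _ ≤ _ := integral_mono (((h.integrable n).const_mul θ).add (integrable_const _))
        (h.integrable_exp_mul n θ) fun ω => Real.add_one_le_exp _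

lemma exp_le_of_abs_le {x η : ℝ} (hx : |x| ≤ 1) (hxη : |x| ≤ η) :
    Real.exp x ≤ 1 + x + (1 + η) * (x ^ 2 / 2) := by
  have h := Real.exp_bound hx (n := 3) (by norm_num)
  simp only [Finset.sum_range_succ, Finset.sum_range_zero] at h
  norm_num [Nat.factorial] at h
  have h1 := (abs_le.1 h).2
  have h2 : |x| ^ 3 ≤ η * x ^ 2 := by
    rw [pow_succ', sq_abs]; gcongr
  nlinarith [sq_nonneg x, abs_nonneg x, pow_nonneg (abs_nonneg x) 3]

lemma exists_mgf_le (h : IsBoundedStandardIID μ Z B) {η : ℝ} (hη : 0 < η) :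
    ∃ δ > 0, ∀ θ, |θ| ≤ δ → ∫ ω, Real.exp (θ * Z 0 ω) ∂μ ≤ Real.exp ((1 + η) * (θ ^ 2 / 2)) := by
  have hB := h.bound_nonneg
  refine ⟨min 1 η / (B + 1), by positivity, fun θ hθ => ?_⟩
  have hi1 : Integrable (fun ω => θ * Z 0 ω) μ := (h.integrable 0).const_mul θ
  have hi2 : Integrable (fun ω => (1 + η) * (θ ^ 2 / 2) * Z 0 ω ^ 2) μ :=
    (h.integrable_sq 0).const_mul _
  have key : ∀ᵐ ω ∂μ, Real.exp (θ * Z 0 ω) ≤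
      1 + θ * Z 0 ω + (1 + η) * (θ ^ 2 / 2) * Z 0 ω ^ 2 := by
    filter_upwards [h.bdd] with ω hω
    have hle : |θ * Z 0 ω| ≤ min 1 η := by
      rw [abs_mul]
      calc |θ| * |Z 0 ω| ≤ min 1 η / (B + 1) * (B + 1) := by
            gcongr
            exact hω.trans (by linarith)
        _ = min 1 η := by field_simp
    refine (exp_le_of_abs_le (hle.trans (min_le_left _ _))
      (hle.trans (min_le_right _ _))).trans_eq (by ring)
  calc ∫ ω, Real.exp (θ * Z 0 ω) ∂μ
      ≤ ∫ ω, (1 + θ * Z 0 ω + (1 + η) * (θ ^ 2 / 2) * Z 0 ω ^ 2) ∂μ :=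
        integral_mono_ae (h.integrable_exp_mul 0 θ) (((integrable_const _).add hi1).add hi2) key
    _ = 1 + (1 + η) * (θ ^ 2 / 2) := by
        have h1 : Integrable (fun ω => 1 + θ * Z 0 ω) μ := (integrable_const _).add hi1
        rw [integral_add h1 hi2, integral_add (integrable_const _) hi1, integral_const_mul,
          integral_const_mul, h.mean, h.var]
        simp
    _ ≤ _ := by rw [add_comm]; exact Real.add_one_le_exp _

/-- Doob's maximal inequality for the exponential submartingale. -/
lemma measure_exists_le_sum_le (h : IsBoundedStandardIID μ Z B) {θ : ℝ} (hθ : 0 ≤ θ) (x : ℝ)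
    (n : ℕ) :
    μ {ω | ∃ k ≤ n, x ≤ ∑ i ∈ Finset.range k, Z i ω} ≤
      ENNReal.ofReal (Real.exp (-(θ * x)) * (∫ ω, Real.exp (θ * Z 0 ω) ∂μ) ^ n) := by
  have hmgf (i : ℕ) : ∫ ω, Real.exp (θ * Z i ω) ∂μ = ∫ ω, Real.exp (θ * Z 0 ω) ∂μ :=
    ((h.ident i).comp (u := fun x => Real.exp (θ * x)) (by fun_prop)).integral_eq
  set M : ℕ → Ω → ℝ := fun k ω => Real.exp (θ * ∑ i ∈ Finset.range k, Z i ω) with hM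
  have hMmul (k : ℕ) (ω : Ω) : M (k + 1) ω = M k ω * Real.exp (θ * Z k ω) := by
    simp only [hM, Finset.sum_range_succ, mul_add, Real.exp_add]
  let m : ℕ → MeasurableSpace Ω := fun i => MeasurableSpace.comap (Z i) inferInstance
  have hm_le (i : ℕ) : m i ≤ ‹MeasurableSpace Ω› := (h.meas i).comap_le
  let 𝒢 : Filtration ℕ ‹MeasurableSpace Ω› :=
    { seq := fun n => ⨆ i ∈ Set.Iio n, m i
      mono' := fun a b hab => biSup_mono fun i hi => lt_of_lt_of_le hi hab
      le' := fun n => iSup₂_le fun i _ => hm_le i }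
  have hadapt (k : ℕ) : Measurable[𝒢 k] (M k) := by
    have : Measurable[𝒢 k] (fun ω => ∑ i ∈ Finset.range k, Z i ω) := by
      refine Finset.measurable_fun_sum _ fun i hi => ?_
      exact Measurable.mono (comap_measurable (Z i))
        (le_iSup₂_of_le (f := fun i _ => m i) i (Finset.mem_range.1 hi) le_rfl) le_rfl
    exact Real.measurable_exp.comp (this.const_mul θ)
  have hind (k : ℕ) : Indep (𝒢 k) (m k) μ := by
    have := indep_iSup_of_disjoint hm_le h.indep (S := Set.Iio k) (T := {k}) (by simp)
    rwa [iSup_singleton] at this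
  have hindf (k : ℕ) (g : Ω → ℝ) (hg : Measurable[𝒢 k] g) :
      IndepFun g (fun ω => Real.exp (θ * Z k ω)) μ := by
    have h1 : Measurable[m k] (fun ω => Real.exp (θ * Z k ω)) :=
      Real.measurable_exp.comp ((comap_measurable (Z k)).const_mul θ)
    exact indep_of_indep_of_le_left (indep_of_indep_of_le_right (hind k) h1.comap_le) hg.comap_le
  have hMint (k : ℕ) : Integrable (M k) μ ∧
      ∫ ω, M k ω ∂μ = (∫ ω, Real.exp (θ * Z 0 ω) ∂μ) ^ k := by
    induction k with
    | zero => simp [hM]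
    | succ k ih =>
      have he : M (k + 1) = M k * fun ω => Real.exp (θ * Z k ω) := funext (hMmul k)
      have hi := hindf k _ (hadapt k)
      rw [he]
      refine ⟨hi.integrable_mul ih.1 (h.integrable_exp_mul k θ), ?_⟩
      rw [hi.integral_mul_eq_mul_integral ih.1.aestronglyMeasurable
        (h.integrable_exp_mul k θ).aestronglyMeasurable, ih.2, hmgf k, pow_succ]
  have hsub : Submartingale M 𝒢 μ := by
    refine submartingale_of_setIntegral_le_succ (fun k => (hadapt k).stronglyMeasurable)
      (fun k => (hMint k).1) fun k s hs => ?_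
    have hs' : MeasurableSet s := 𝒢.le k _ hs
    rw [← integral_indicator hs', ← integral_indicator hs']
    have he : s.indicator (M (k + 1)) = s.indicator (M k) * fun ω => Real.exp (θ * Z k ω) := by
      ext ω
      by_cases hω : ω ∈ s <;> simp [hω, hMmul]
    have hi := hindf k (s.indicator (M k)) ((hadapt k).indicator hs)
    rw [he, hi.integral_mul_eq_mul_integral ((hMint k).1.indicator hs').aestronglyMeasurable
        (h.integrable_exp_mul k θ).aestronglyMeasurable]
    refine le_mul_of_one_le_right (integral_nonneg fun ω => ?_) (h.one_le_mgf k θ)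
    exact Set.indicator_nonneg (fun _ _ => (Real.exp_pos _).le) _
  have hmax := maximal_ineq hsub (fun k ω => (Real.exp_pos _).le)
    (ε := (Real.exp (θ * x)).toNNReal) n
  rw [Real.coe_toNNReal _ (Real.exp_pos _).le] at hmax
  have hset : {ω | ∃ k ≤ n, x ≤ ∑ i ∈ Finset.range k, Z i ω} ⊆
      {ω | Real.exp (θ * x) ≤
        (Finset.range (n + 1)).sup' Finset.nonempty_range_add_one fun k => M k ω} := by
    rintro ω ⟨k, hk, hx⟩
    have hle : Real.exp (θ * x) ≤ M k ω := Real.exp_le_exp.2 (mul_le_mul_of_nonneg_left hx hθ)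
    exact hle.trans (Finset.le_sup' (fun k => M k ω) (Finset.mem_range.2 (Nat.lt_succ_of_le hk)))
  have hle := hmax.trans (ENNReal.ofReal_le_ofReal
    (setIntegral_le_integral (hMint n).1 (ae_of_all _ fun ω => (Real.exp_pos _).le)))
  rw [(hMint n).2] at hle
  refine (measure_mono hset).trans ?_
  rw [Real.exp_neg, ENNReal.ofReal_mul (by positivity), ENNReal.ofReal_inv_of_pos (Real.exp_pos _),
    mul_comm (ENNReal.ofReal (Real.exp (θ * x)))⁻¹, ← div_eq_mul_inv,
    ENNReal.le_div_iff_mul_le (by simp [Real.exp_pos]) (by simp), mul_comm]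
  exact hle

end IsBoundedStandardIID

/-- The normalisation `√(2 x log log x)` of the law of the iterated logarithm. -/
noncomputable def lilNorm (x : ℝ) : ℝ := √(2 * x * Real.log (Real.log x))

lemma lilNorm_nonneg (x : ℝ) : 0 ≤ lilNorm x := Real.sqrt_nonneg _

lemma log_log_nonneg {x : ℝ} (hx : Real.exp 1 ≤ x) : 0 ≤ Real.log (Real.log x) :=
  Real.log_nonneg ((Real.le_log_iff_exp_le ((Real.exp_pos 1).trans_le hx)).2 hx)

lemma lilNorm_sq {x : ℝ} (hx : Real.exp 1 ≤ x) :
    lilNorm x ^ 2 = 2 * x * Real.log (Real.log x) :=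
  Real.sq_sqrt (mul_nonneg (by linarith [Real.exp_pos 1]) (log_log_nonneg hx))

lemma lilNorm_mono {x y : ℝ} (hx : Real.exp 1 ≤ x) (hxy : x ≤ y) : lilNorm x ≤ lilNorm y := by
  have h0 : 0 < x := (Real.exp_pos 1).trans_le hx
  have h1 : 0 < Real.log x :=
    zero_lt_one.trans_le ((Real.le_log_iff_exp_le h0).2 hx)
  have h2 := log_log_nonneg hx
  have h3 : 0 ≤ y := h0.le.trans hxy
  unfold lilNorm
  gcongr

lemma tendsto_log_log_atTop : Tendsto (fun x => Real.log (Real.log x)) atTop atTop :=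
  Real.tendsto_log_atTop.comp Real.tendsto_log_atTop

lemma tendsto_lilNorm_div : Tendsto (fun x => lilNorm x / x) atTop (𝓝 0) := by
  have h1 : Tendsto (fun x : ℝ => 2 * (Real.log x / x)) atTop (𝓝 0) := by
    simpa using (Real.isLittleO_log_id_atTop.tendsto_div_nhds_zero).const_mul 2
  have h2 : Tendsto (fun x : ℝ => √(2 * (Real.log x / x))) atTop (𝓝 0) := by
    have := (Real.continuous_sqrt.tendsto 0).comp h1
    rwa [Real.sqrt_zero] at this
  refine squeeze_zero' ?_ ?_ h2
  · filter_upwards [eventually_ge_atTop 0] with x hx using div_nonneg (lilNorm_nonneg _) hx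
  · filter_upwards [eventually_ge_atTop (Real.exp 1)] with x hx
    have h0 : 0 < x := (Real.exp_pos 1).trans_le hx
    have hl : 1 ≤ Real.log x := (Real.le_log_iff_exp_le h0).2 hx
    refine Real.le_sqrt_of_sq_le ?_
    rw [div_pow, lilNorm_sq hx]
    have : Real.log (Real.log x) ≤ Real.log x := Real.log_le_self (by linarith)
    calc 2 * x * Real.log (Real.log x) / x ^ 2 = 2 * (Real.log (Real.log x) / x) := by field_simp
      _ ≤ _ := by gcongr

lemma tendsto_lilNorm_atTop : Tendsto lilNorm atTop atTop := by
  refine Real.tendsto_sqrt_atTop.comp ?_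
  exact (tendsto_id.const_mul_atTop two_pos).atTop_mul_atTop₀ tendsto_log_log_atTop

/-- The first Borel-Cantelli lemma with an eventual summable bound. -/
lemma ae_eventually_notMem_of_le {Ω : Type*} [MeasurableSpace Ω] {μ : Measure Ω}
    {E : ℕ → Set Ω} {f : ℕ → ℝ} (hf : Summable f)
    (h : ∀ᶠ k in atTop, μ (E k) ≤ ENNReal.ofReal (f k)) : ∀ᵐ ω ∂μ, ∀ᶠ k in atTop, ω ∉ E k := by
  obtain ⟨K, hK⟩ := eventually_atTop.1 h
  have hs : ∑' k, μ (E (k + K)) ≠ ⊤ := by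
    refine ne_top_of_le_ne_top ((summable_nat_add_iff K).2 hf).tsum_ofReal_ne_top
      (ENNReal.tsum_le_tsum fun k => hK _ (Nat.le_add_left _ _))
  filter_upwards [ae_eventually_notMem hs] with ω hω
  obtain ⟨k₀, hk₀⟩ := eventually_atTop.1 hω
  filter_upwards [eventually_ge_atTop (k₀ + K)] with k hk
  have := hk₀ (k - K) (by omega)
  rwa [Nat.sub_add_cancel (by omega)] at this

/-- A divergence criterion against the harmonic series. -/
lemma tsum_eq_top_of_one_div_le {f : ℕ → ENNReal}
    (h : ∀ᶠ k : ℕ in atTop, ENNReal.ofReal (1 / k) ≤ f k) : ∑' k, f k = ⊤ := by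
  by_contra hne
  have hs := ENNReal.summable_toReal hne
  refine Real.not_summable_one_div_natCast ?_
  refine Summable.of_norm_bounded_eventually_nat hs ?_
  filter_upwards [h] with k hk
  rw [Real.norm_of_nonneg (by positivity)]
  exact (ENNReal.ofReal_le_iff_le_toReal (ENNReal.ne_top_of_tsum_ne_top hne k)).1 hk

namespace IsBoundedStandardIID

variable {Ω : Type*} [MeasurableSpace Ω] {μ : Measure Ω} [IsProbabilityMeasure μ]
  {Z : ℕ → Ω → ℝ} {B : ℝ}

/-- The upper half of the law of the iterated logarithm. -/
lemma ae_eventually_sum_le (h : IsBoundedStandardIID μ Z B) {ε : ℝ} (hε : 0 < ε) :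
    ∀ᵐ ω ∂μ, ∀ᶠ n : ℕ in atTop, ∑ i ∈ Finset.range n, Z i ω ≤ (1 + ε) * lilNorm n := by
  set c := √(1 + ε) with hc
  have hcsq : c ^ 2 = 1 + ε := Real.sq_sqrt (by linarith)
  have hc1 : 1 < c := by
    rw [hc, Real.lt_sqrt zero_le_one]; linarith
  have hc0 : 0 < c := by linarith
  have hlogc : 0 < Real.log c := Real.log_pos hc1
  obtain ⟨δ, hδ, hmgf⟩ := h.exists_mgf_le (η := c - 1) (by linarith)
  have hpow : Tendsto (fun k : ℕ => c ^ k) atTop atTop := tendsto_pow_atTop_atTop_of_one_lt hc1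
  let E : ℕ → Set Ω := fun k =>
    {ω | ∃ j ≤ ⌊c ^ (k + 1)⌋₊, (1 + ε) * lilNorm (c ^ k) ≤ ∑ i ∈ Finset.range j, Z i ω}
  have hsum : Summable fun k : ℕ => (Real.log c) ^ (-(1 + ε)) * (k : ℝ) ^ (-(1 + ε)) :=
    (Real.summable_nat_rpow.2 (by linarith)).mul_left _
  have hE : ∀ᶠ k : ℕ in atTop, μ (E k) ≤
      ENNReal.ofReal ((Real.log c) ^ (-(1 + ε)) * (k : ℝ) ^ (-(1 + ε))) := by
    filter_upwards [hpow.eventually_ge_atTop (Real.exp 1), eventually_gt_atTop 0,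
      (tendsto_lilNorm_div.comp hpow).eventually_le_const hδ] with k hk hk0 hkδ
    set u := c ^ k with hu
    have hu0 : 0 < u := by positivity
    have hsq := lilNorm_sq hk
    have hθ : 0 ≤ lilNorm u / u := div_nonneg (lilNorm_nonneg _) hu0.le
    refine (h.measure_exists_le_sum_le hθ _ _).trans (ENNReal.ofReal_le_ofReal ?_)
    have hN : (⌊c ^ (k + 1)⌋₊ : ℝ) ≤ c * u := by
      rw [hu, ← pow_succ']; exact Nat.floor_le (by positivity)
    have hlog : Real.log u = k * Real.log c := by rw [hu, Real.log_pow]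
    have hk0' : (0 : ℝ) < k := by exact_mod_cast hk0
    calc Real.exp (-(lilNorm u / u * ((1 + ε) * lilNorm u))) *
          (∫ ω, Real.exp (lilNorm u / u * Z 0 ω) ∂μ) ^ ⌊c ^ (k + 1)⌋₊
        ≤ Real.exp (-(lilNorm u / u * ((1 + ε) * lilNorm u))) *
          Real.exp ((1 + (c - 1)) * ((lilNorm u / u) ^ 2 / 2)) ^ ⌊c ^ (k + 1)⌋₊ := by
          have h0 : 0 ≤ ∫ ω, Real.exp (lilNorm u / u * Z 0 ω) ∂μ :=
            integral_nonneg fun _ => (Real.exp_pos _).le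
          have h1 := hmgf (lilNorm u / u) (by rw [abs_of_nonneg hθ]; exact hkδ)
          gcongr
      _ = Real.exp (-(lilNorm u / u * ((1 + ε) * lilNorm u)) +
          ⌊c ^ (k + 1)⌋₊ * (c * ((lilNorm u / u) ^ 2 / 2))) := by
          rw [← Real.exp_nat_mul, ← Real.exp_add]; congr 3; ring
      _ ≤ Real.exp (-(lilNorm u / u * ((1 + ε) * lilNorm u)) +
          c * u * (c * ((lilNorm u / u) ^ 2 / 2))) := by gcongr
      _ = Real.exp (-(1 + ε) * Real.log (Real.log u)) := by
          congr 1
          have e1 : lilNorm u / u * ((1 + ε) * lilNorm u) = (1 + ε) * lilNorm u ^ 2 / u := by ring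
          have e2 : c * u * (c * ((lilNorm u / u) ^ 2 / 2)) = c ^ 2 * lilNorm u ^ 2 / (2 * u) := by
            field_simp
          rw [e1, e2, hcsq, hsq]
          field_simp
          ring
      _ = _ := by
          rw [hlog, mul_comm (-(1 + ε)), ← Real.rpow_def_of_pos (by positivity),
            Real.mul_rpow hk0'.le hlogc.le, mul_comm]
  filter_upwards [ae_eventually_notMem_of_le hsum hE] with ω hω
  obtain ⟨K, hK⟩ := eventually_atTop.1 (hω.and (hpow.eventually_ge_atTop (Real.exp 1)))
  filter_upwards [tendsto_natCast_atTop_atTop.eventually_ge_atTop (c ^ K),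
    eventually_ge_atTop 1] with n hn hn1
  obtain ⟨k, hk1, hk2⟩ := exists_nat_pow_near (x := (n : ℝ)) (by exact_mod_cast hn1) hc1
  have hKk : K ≤ k := by
    have := (pow_lt_pow_iff_right₀ hc1).1 (hn.trans_lt hk2)
    omega
  obtain ⟨h1, h2⟩ := hK k hKk
  have h3 : ∑ i ∈ Finset.range n, Z i ω < (1 + ε) * lilNorm (c ^ k) := by
    by_contra hcon
    exact h1 ⟨n, Nat.le_floor hk2.le, not_lt.1 hcon⟩
  refine h3.le.trans ?_
  gcongr
  exact lilNorm_mono h2 hk1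

/-- A lower bound for the upper tail of the standard normal law. -/
lemma _root_.exists_exp_lt_gaussianReal_Ioi {κ : ℝ} (hκ : 1 < κ) :
    ∃ y : ℝ, 2 ≤ y ∧
      ENNReal.ofReal (Real.exp (-(κ * y ^ 2 / 2))) < gaussianReal 0 1 (Set.Ioi y) := by
  have hpi : 0 < √(2 * Real.pi) := by positivity
  have ht : Tendsto (fun y : ℝ => (κ - 1) / 2 * y ^ 2 + (-1) * y + (-(1 / 2)
      - Real.log (√(2 * Real.pi)))) atTop atTop := by
    refine tendsto_atTop_add_const_right _ _ ?_
    have : Tendsto (fun y : ℝ => y * ((κ - 1) / 2 * y + (-1))) atTop atTop :=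
      tendsto_id.atTop_mul_atTop₀
        (tendsto_atTop_add_const_right _ _ (tendsto_id.const_mul_atTop (by linarith)))
    exact this.congr fun y => by ring
  obtain ⟨y, hy, hy2⟩ := ((ht.eventually_gt_atTop 0).and (eventually_ge_atTop 2)).exists
  refine ⟨y, hy2, ?_⟩
  set b := Real.exp (-((y + 1) ^ 2 / 2)) / √(2 * Real.pi) with hb
  have h1 : Real.exp (-(κ * y ^ 2 / 2)) < b := by
    have : Real.exp (-(κ * y ^ 2 / 2)) * √(2 * Real.pi) =
        Real.exp (-(κ * y ^ 2 / 2) + Real.log (√(2 * Real.pi))) := by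
      rw [Real.exp_add, Real.exp_log hpi]
    rw [hb, lt_div_iff₀ hpi, this]
    exact Real.exp_lt_exp.2 (by nlinarith)
  have hpdf : ∀ x ∈ Set.Ioc y (y + 1), ENNReal.ofReal b ≤ gaussianPDF 0 1 x := by
    intro x hx
    refine ENNReal.ofReal_le_ofReal ?_
    simp only [gaussianPDFReal, hb, NNReal.coe_one, mul_one, sub_zero]
    rw [div_eq_inv_mul, neg_div]
    gcongr
    · linarith [hx.1]
    · exact hx.2
  calc ENNReal.ofReal (Real.exp (-(κ * y ^ 2 / 2))) < ENNReal.ofReal b :=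
        (ENNReal.ofReal_lt_ofReal_iff (by positivity)).2 h1
    _ = ∫⁻ _ in Set.Ioc y (y + 1), ENNReal.ofReal b := by simp
    _ ≤ ∫⁻ x in Set.Ioc y (y + 1), gaussianPDF 0 1 x :=
        setLIntegral_mono (measurable_gaussianPDF 0 1) hpdf
    _ = gaussianReal 0 1 (Set.Ioc y (y + 1)) := (gaussianReal_apply 0 one_ne_zero _).symm
    _ ≤ _ := measure_mono Set.Ioc_subset_Ioi_self

lemma eventually_lt_measure_sum (h : IsBoundedStandardIID μ Z B) (y : ℝ) {q : ENNReal}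
    (hq : q < gaussianReal 0 1 (Set.Ioi y)) :
    ∀ᶠ l : ℕ in atTop, q ≤ μ {ω | y * √l ≤ ∑ i ∈ Finset.range l, Z i ω} := by
  have hclt := tendstoInDistribution_inv_sqrt_mul_sum (P := μ) (P' := gaussianReal 0 1) (Y := id)
    HasLaw.id h.mean h.var h.indep h.ident
  have hlim := ProbabilityMeasure.le_liminf_measure_open_of_tendsto hclt.tendsto
    (isOpen_Ioi (a := y))
  have hlt := hq.trans_le (by simpa using hlim)
  filter_upwards [eventually_lt_of_lt_liminf hlt, eventually_gt_atTop 0] with l hl hl0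
  have hm : Measurable fun ω => (√(l : ℝ))⁻¹ * ∑ i ∈ Finset.range l, Z i ω :=
    (Finset.measurable_fun_sum _ fun i _ => h.meas i).const_mul _
  rw [Measure.map_apply hm measurableSet_Ioi] at hl
  refine hl.le.trans (measure_mono fun ω hω => ?_)
  have hl0' : 0 < √(l : ℝ) := Real.sqrt_pos.2 (by exact_mod_cast hl0)
  simp only [Set.mem_preimage, Set.mem_Ioi] at hω
  rw [inv_mul_eq_div, lt_div_iff₀ hl0'] at hω
  exact hω.le

omit [IsProbabilityMeasure μ] in
lemma measure_le_sum_Ico (h : IsBoundedStandardIID μ Z B) (t l : ℕ) (z : ℝ) :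
    μ {ω | z ≤ ∑ i ∈ Finset.Ico t (t + l), Z i ω} =
      μ {ω | z ≤ ∑ i ∈ Finset.range l, Z i ω} := by
  have hid : IdentDistrib (fun ω i => Z (t + i) ω) (fun ω i => Z i ω) μ μ :=
    IdentDistrib.pi (fun i => (h.ident (t + i)).trans (h.ident i).symm)
      (h.indep.precomp (add_right_injective t)) h.indep
  have hs : MeasurableSet {x : ℕ → ℝ | z ≤ ∑ i ∈ Finset.range l, x i} :=
    measurableSet_le measurable_const (by fun_prop)
  simpa [Finset.sum_Ico_eq_sum_range] using hid.measure_mem_eq hs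

omit [IsProbabilityMeasure μ] in
lemma indepFun_sum (h : IsBoundedStandardIID μ Z B) {S T : Finset ℕ} (hST : Disjoint S T) :
    IndepFun (fun ω => ∑ i ∈ S, Z i ω) (fun ω => ∑ i ∈ T, Z i ω) μ := by
  have := (h.indep.indepFun_finset S T hST h.meas).comp
    (φ := fun x : S → ℝ => ∑ i, x i) (ψ := fun x : T → ℝ => ∑ i, x i)
    (by fun_prop) (by fun_prop)
  convert! this using 1
  · ext ω; exact (Finset.sum_coe_sort S fun i => Z i ω).symm
  · ext ω; exact (Finset.sum_coe_sort T fun i => Z i ω).symm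

/-- A block sum over `m` blocks of length `l` is large if all the blocks are. -/
lemma pow_le_measure_le_sum_Ico (h : IsBoundedStandardIID μ Z B) (t l m : ℕ) (z : ℝ) :
    μ {ω | z ≤ ∑ i ∈ Finset.range l, Z i ω} ^ m ≤
      μ {ω | m * z ≤ ∑ i ∈ Finset.Ico t (t + m * l), Z i ω} := by
  induction m with
  | zero => simp
  | succ m ih =>
    have hd : Disjoint (Finset.Ico t (t + m * l)) (Finset.Ico (t + m * l) (t + m * l + l)) :=
      Finset.Ico_disjoint_Ico_consecutive _ _ _
    have hind := (h.indepFun_sum hd).measure_inter_preimage_eq_mul (Set.Ici (m * z)) (Set.Ici z)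
      measurableSet_Ici measurableSet_Ici
    calc μ {ω | z ≤ ∑ i ∈ Finset.range l, Z i ω} ^ (m + 1)
        ≤ μ {ω | m * z ≤ ∑ i ∈ Finset.Ico t (t + m * l), Z i ω} *
          μ {ω | z ≤ ∑ i ∈ Finset.Ico (t + m * l) (t + m * l + l), Z i ω} := by
          rw [pow_succ, h.measure_le_sum_Ico (t + m * l)]
          gcongr
      _ ≤ _ := by
          refine hind.symm.le.trans (measure_mono ?_)
          rintro ω ⟨h1, h2⟩
          simp only [Set.mem_preimage, Set.mem_Ici] at h1 h2
          have e := Finset.sum_Ico_consecutive (fun i => Z i ω) (Nat.le_add_right t (m * l))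
            (Nat.le_add_right (t + m * l) l)
          rw [Set.mem_ofPred_eq, show t + (m + 1) * l = t + m * l + l by ring, ← e]
          push_cast
          linarith

lemma iIndepSet_le_sum_Ico (h : IsBoundedStandardIID μ Z B) {a b : ℕ → ℕ} (ha : Monotone a)
    (hb : ∀ k, b k ≤ a (k + 1)) (z : ℕ → ℝ) :
    iIndepSet (fun k => {ω | z k ≤ ∑ i ∈ Finset.Ico (a k) (b k), Z i ω}) μ := by
  let m : ℕ → MeasurableSpace Ω := fun i => MeasurableSpace.comap (Z i) inferInstance
  have hm_le (i : ℕ) : m i ≤ ‹MeasurableSpace Ω› := (h.meas i).comap_le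
  have hM : iIndep (fun k => ⨆ i ∈ Set.Ico (a k) (b k), m i) μ := by
    refine iIndep_of_indep_iSup_lt fun n => ?_
    have hd : Disjoint (Set.Iio (a n)) (Set.Ico (a n) (b n)) :=
      Set.disjoint_left.2 fun i hi hi' => absurd hi'.1 (not_le.2 hi)
    refine indep_of_indep_of_le_left (indep_iSup_of_disjoint hm_le h.indep hd) ?_
    refine iSup₂_le fun k hk => iSup₂_le fun i hi => ?_
    exact le_iSup₂_of_le (f := fun i _ => m i) i
      (hi.2.trans_le ((hb k).trans (ha (Nat.succ_le_of_lt hk)))) le_rfl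
  have hmeas (k : ℕ) : MeasurableSet[⨆ i ∈ Set.Ico (a k) (b k), m i]
      {ω | z k ≤ ∑ i ∈ Finset.Ico (a k) (b k), Z i ω} := by
    have : Measurable[⨆ i ∈ Set.Ico (a k) (b k), m i]
        fun ω => ∑ i ∈ Finset.Ico (a k) (b k), Z i ω :=
      Finset.measurable_fun_sum _ fun i hi => Measurable.mono (comap_measurable (Z i))
        (le_iSup₂_of_le (f := fun i _ => m i) i (Finset.mem_Ico.1 hi) le_rfl) le_rfl
    exact this measurableSet_Ici
  refine (iIndepSet_iff_meas_biInter fun k => ?_).2 fun s => hM.meas_biInter fun k _ => hmeas k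
  exact (iSup₂_le fun i _ => hm_le i) _ (hmeas k)

lemma _root_.eventually_log_log_factorial_le {ε : ℝ} (hε : 0 < ε) :
    ∀ᶠ k : ℕ in atTop,
      Real.log (Real.log ((k + 1).factorial : ℝ)) ≤ (1 + ε) * Real.log k := by
  have ho := (isLittleO_log_rpow_atTop hε).bound (c := 1 / 4) (by norm_num)
  filter_upwards [tendsto_natCast_atTop_atTop.eventually ho, eventually_ge_atTop 2] with k hk hk2
  have hk2' : (2 : ℝ) ≤ k := by exact_mod_cast hk2
  have hk0 : (0 : ℝ) < k := by linarith
  have hlog : 0 < Real.log k := Real.log_pos (by linarith)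
  rw [Real.norm_of_nonneg hlog.le, Real.norm_of_nonneg (by positivity)] at hk
  have h1 : Real.log ((k + 1).factorial : ℝ) ≤ (k + 1) * Real.log (k + 1) := by
    have : ((k + 1).factorial : ℝ) ≤ ((k : ℝ) + 1) ^ (k + 1) := by
      exact_mod_cast Nat.factorial_le_pow (k + 1)
    calc Real.log ((k + 1).factorial : ℝ) ≤ Real.log (((k : ℝ) + 1) ^ (k + 1)) :=
          Real.log_le_log (by positivity) this
      _ = _ := by rw [Real.log_pow]; push_cast; ring
  have h2 : Real.log ((k : ℝ) + 1) ≤ 2 * Real.log k := by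
    calc Real.log ((k : ℝ) + 1) ≤ Real.log ((k : ℝ) ^ 2) :=
          Real.log_le_log (by positivity) (by nlinarith)
      _ = _ := by rw [Real.log_pow]; norm_num
  have h3 : Real.log ((k + 1).factorial : ℝ) ≤ (k : ℝ) ^ (1 + ε) := by
    rw [Real.rpow_add hk0, Real.rpow_one]
    calc Real.log ((k + 1).factorial : ℝ) ≤ (k + 1) * Real.log (k + 1) := h1
      _ ≤ (2 * k) * (2 * Real.log k) :=
          mul_le_mul (by linarith) h2 (Real.log_nonneg (by linarith)) (by positivity)
      _ ≤ (2 * k) * (2 * (1 / 4 * (k : ℝ) ^ ε)) := by gcongr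
      _ = _ := by ring
  rw [← Real.log_rpow hk0]
  refine Real.log_le_log (Real.log_pos ?_) h3
  exact_mod_cast Nat.one_lt_factorial.2 (by omega)

/-- The lower half of the law of the iterated logarithm. -/
lemma ae_frequently_le_sum (h : IsBoundedStandardIID μ Z B) {ε : ℝ} (hε : 0 < ε) (hε1 : ε < 1) :
    ∀ᵐ ω ∂μ, ∃ᶠ n : ℕ in atTop, (1 - ε) * lilNorm n ≤ ∑ i ∈ Finset.range n, Z i ω := by
  obtain ⟨y, hy2, hy⟩ := exists_exp_lt_gaussianReal_Ioi (κ := 1 + ε) (by linarith)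
  have hy0 : 0 < y := by linarith
  set a := (1 + ε) * y ^ 2 / 2 with ha
  have ha1 : 1 ≤ a := by rw [ha]; nlinarith
  have ha0 : 0 < a := by linarith
  let m : ℕ → ℕ := fun k => ⌊Real.log k / a⌋₊
  have hmk (k : ℕ) : m k ≤ k := by
    refine Nat.floor_le_of_le ((div_le_self (Real.log_natCast_nonneg k) ha1).trans ?_)
    exact Real.log_le_self (Nat.cast_nonneg k)
  have hm_atTop : Tendsto m atTop atTop :=
    tendsto_nat_floor_atTop.comp ((Real.tendsto_log_atTop.comp tendsto_natCast_atTop_atTop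
      ).atTop_div_const ha0)
  have hfac : Tendsto Nat.factorial atTop atTop :=
    tendsto_atTop_mono Nat.self_le_factorial tendsto_id
  let E : ℕ → Set Ω := fun k => {ω | m k * (y * √(k.factorial : ℝ)) ≤
    ∑ i ∈ Finset.Ico k.factorial (k.factorial + m k * k.factorial), Z i ω}
  have hEind : iIndepSet E μ :=
    h.iIndepSet_le_sum_Ico (fun _ _ hab => Nat.factorial_le hab) (fun k => by
      rw [Nat.factorial_succ, add_mul, one_mul, add_comm]
      gcongr
      exact hmk k) fun k => m k * (y * √(k.factorial : ℝ))
  have hEmeas (k : ℕ) : MeasurableSet (E k) :=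
    measurableSet_le measurable_const (Finset.measurable_fun_sum _ fun i _ => h.meas i)
  have hEle : ∀ᶠ k : ℕ in atTop, ENNReal.ofReal (1 / k) ≤ μ (E k) := by
    filter_upwards [hfac.eventually (h.eventually_lt_measure_sum y hy), eventually_gt_atTop 0]
      with k hk hk0
    have hk0' : (0 : ℝ) < k := by exact_mod_cast hk0
    refine le_trans ?_ (h.pow_le_measure_le_sum_Ico k.factorial k.factorial (m k)
      (y * √(k.factorial : ℝ)))
    refine le_trans ?_ (pow_le_pow_left' hk (m k))
    rw [← ENNReal.ofReal_pow (Real.exp_pos _).le]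
    refine ENNReal.ofReal_le_ofReal ?_
    rw [← Real.exp_nat_mul, one_div, ← Real.exp_log (inv_pos.2 hk0'), Real.log_inv]
    refine Real.exp_le_exp.2 ?_
    have : (m k : ℝ) ≤ Real.log k / a :=
      Nat.floor_le (div_nonneg (Real.log_natCast_nonneg k) ha0.le)
    rw [le_div_iff₀ ha0] at this
    linarith
  have hBC : ∀ᵐ ω ∂μ, ω ∈ limsup E atTop := by
    have := measure_limsup_eq_one hEmeas hEind (tsum_eq_top_of_one_div_le hEle)
    rwa [← mem_ae_iff_prob_eq_one (MeasurableSet.measurableSet_limsup hEmeas)] at this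
  have hMbig : ∀ᶠ M : ℕ in atTop, 1 + 2 * (1 + ε) * √((M : ℝ) + 1) ≤ ε ^ 2 * (M + 1) := by
    have hlim : Tendsto (fun M : ℕ => √((M : ℝ) + 1)) atTop atTop :=
      Real.tendsto_sqrt_atTop.comp (tendsto_natCast_atTop_atTop.atTop_add tendsto_const_nhds)
    filter_upwards [hlim.eventually_ge_atTop 1,
      hlim.eventually_ge_atTop ((3 + 2 * ε) / ε ^ 2)] with M h1 h2
    rw [div_le_iff₀ (by positivity)] at h2
    nlinarith [Real.sq_sqrt (show (0 : ℝ) ≤ (M : ℝ) + 1 by positivity)]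
  filter_upwards [hBC, h.neg.ae_eventually_sum_le zero_lt_one] with ω hω1 hω2
  have hfreq : ∃ᶠ k in atTop, ω ∈ E k := by
    rwa [mem_limsup_iff_frequently_mem] at hω1
  have hn_atTop : Tendsto (fun k => k.factorial + m k * k.factorial) atTop atTop :=
    tendsto_atTop_mono (fun k => Nat.le_add_right _ _) hfac
  refine hn_atTop.frequently ?_
  refine (hfreq.and_eventually ((hfac.eventually hω2).and ((eventually_log_log_factorial_le hε).and
    ((hm_atTop.eventually hMbig).and (eventually_ge_atTop 3))))).mono ?_
  rintro k ⟨hEk, hlow, hll, hM, hk3⟩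
  have hw : m k * (y * √(k.factorial : ℝ)) ≤
    ∑ i ∈ Finset.Ico k.factorial (k.factorial + m k * k.factorial), Z i ω := hEk
  set F := √(k.factorial : ℝ) with hF
  have hFsq : F ^ 2 = k.factorial := Real.sq_sqrt (Nat.cast_nonneg _)
  have hF0 : 0 ≤ F := Real.sqrt_nonneg _
  set R := √((m k : ℝ) + 1) with hR
  have hRsq : R ^ 2 = (m k : ℝ) + 1 := Real.sq_sqrt (by positivity)
  have hR0 : 0 ≤ R := Real.sqrt_nonneg _
  have hfe : Real.exp 1 ≤ (k.factorial : ℝ) := by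
    have : (3 : ℝ) ≤ k.factorial := by exact_mod_cast hk3.trans (Nat.self_le_factorial k)
    linarith [Real.exp_one_lt_d9]
  have hll' : ∀ x : ℝ, (k.factorial : ℝ) ≤ x → x ≤ (k + 1).factorial →
      Real.log (Real.log x) ≤ (1 + ε) * (a * R ^ 2) := by
    intro x hx1 hx2
    have hx0 : 0 < x := (Real.exp_pos 1).trans_le (hfe.trans hx1)
    have h1 : 1 ≤ Real.log x := (Real.le_log_iff_exp_le hx0).2 (hfe.trans hx1)
    refine (Real.log_le_log (by linarith) (Real.log_le_log hx0 hx2)).trans (hll.trans ?_)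
    gcongr
    have := (Nat.lt_floor_add_one (Real.log k / a)).le
    rw [div_le_iff₀ ha0] at this
    rw [hRsq, mul_comm]
    exact this
  have hb1 : lilNorm k.factorial ≤ F * ((1 + ε) * y) * R := by
    refine Real.sqrt_le_iff.2 ⟨by positivity, ?_⟩
    have := hll' k.factorial le_rfl (by exact_mod_cast Nat.factorial_le (Nat.le_succ k))
    calc 2 * (k.factorial : ℝ) * Real.log (Real.log k.factorial)
        ≤ 2 * (k.factorial : ℝ) * ((1 + ε) * (a * R ^ 2)) := by gcongr
      _ = _ := by rw [← hFsq, ha]; ring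
  have hb2 : lilNorm ((k.factorial + m k * k.factorial : ℕ) : ℝ) ≤
      F * ((1 + ε) * y) * (m k + 1) := by
    refine Real.sqrt_le_iff.2 ⟨by positivity, ?_⟩
    have := hll' ((k.factorial + m k * k.factorial : ℕ) : ℝ)
      (by exact_mod_cast Nat.le_add_right _ _) (by
        have : k.factorial + m k * k.factorial ≤ (k + 1).factorial := by
          rw [Nat.factorial_succ, add_mul, one_mul, add_comm]
          gcongr
          exact hmk k
        exact_mod_cast this)
    calc 2 * ((k.factorial + m k * k.factorial : ℕ) : ℝ) *
          Real.log (Real.log ((k.factorial + m k * k.factorial : ℕ) : ℝ))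
        ≤ 2 * ((k.factorial + m k * k.factorial : ℕ) : ℝ) * ((1 + ε) * (a * R ^ 2)) := by gcongr
      _ = _ := by rw [hRsq]; push_cast; rw [← hFsq, ha]; ring
  have hsplit := Finset.sum_range_add_sum_Ico (fun i => Z i ω)
    (Nat.le_add_right k.factorial (m k * k.factorial))
  rw [Finset.sum_neg_distrib] at hlow
  have hε2 : 0 ≤ 1 - ε := by linarith
  calc (1 - ε) * lilNorm ((k.factorial + m k * k.factorial : ℕ) : ℝ)
      ≤ (1 - ε) * (F * ((1 + ε) * y) * (m k + 1)) := by
        gcongr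
    _ = F * y * ((m k + 1) - ε ^ 2 * (m k + 1)) := by ring
    _ ≤ F * y * (m k - 2 * (1 + ε) * R) := by
        refine mul_le_mul_of_nonneg_left ?_ (by positivity)
        linarith
    _ = m k * (y * F) - 2 * (F * ((1 + ε) * y) * R) := by ring
    _ ≤ _ := by
        rw [← hsplit]
        linarith

end IsBoundedStandardIID

lemma limsup_eq_of_forall_pos {f : ℕ → ℝ} {s : ℝ}
    (h1 : ∀ ε > 0, ∀ᶠ n in atTop, f n ≤ s + ε) (h2 : ∀ ε > 0, ∃ᶠ n in atTop, s - ε ≤ f n) :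
    limsup f atTop = s := by
  refine le_antisymm (le_of_forall_pos_le_add fun ε hε => ?_)
    (le_of_forall_pos_sub_le fun ε hε => ?_)
  · exact limsup_le_of_le (IsCoboundedUnder.of_frequently_ge (h2 1 one_pos)) (h1 ε hε)
  · exact le_limsup_of_frequently_le (h2 ε hε) (isBoundedUnder_of_eventually_le (h1 1 one_pos))

lemma liminf_eq_of_forall_pos {f : ℕ → ℝ} {s : ℝ}
    (h1 : ∀ ε > 0, ∀ᶠ n in atTop, s - ε ≤ f n) (h2 : ∀ ε > 0, ∃ᶠ n in atTop, f n ≤ s + ε) :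
    liminf f atTop = s := by
  refine le_antisymm (le_of_forall_pos_le_add fun ε hε => ?_)
    (le_of_forall_pos_sub_le fun ε hε => ?_)
  · exact liminf_le_of_frequently_le (h2 ε hε) (isBoundedUnder_of_eventually_ge (h1 1 one_pos))
  · exact le_liminf_of_le (IsCoboundedUnder.of_frequently_le (h2 1 one_pos)) (h1 ε hε)

/-- Iterated logarithm bounds for `T` pass to sequences at bounded distance from `s • T`. -/
lemma lil_bounds_of_abs_sub_le {T W : ℕ → ℝ} {s C : ℝ} (hs : 0 < s)
    (hC : ∀ n, |W n - s * T n| ≤ C)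
    (h1 : ∀ ε > 0, ∀ᶠ n : ℕ in atTop, T n ≤ (1 + ε) * lilNorm n)
    (h2 : ∀ ε > 0, ∃ᶠ n : ℕ in atTop, (1 - ε) * lilNorm n ≤ T n) {ε : ℝ} (hε : 0 < ε) :
    (∀ᶠ n : ℕ in atTop, W n / lilNorm n ≤ s + ε) ∧
      ∃ᶠ n : ℕ in atTop, s - ε ≤ W n / lilNorm n := by
  have hlim : Tendsto (fun n : ℕ => lilNorm n) atTop atTop :=
    tendsto_lilNorm_atTop.comp tendsto_natCast_atTop_atTop
  have hbig : ∀ᶠ n : ℕ in atTop, 0 < lilNorm n ∧ C ≤ ε / 2 * lilNorm n := by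
    filter_upwards [hlim.eventually_gt_atTop 0, hlim.eventually_ge_atTop (2 * C / ε)] with n hn hn'
    rw [div_le_iff₀ hε] at hn'
    exact ⟨hn, by linarith⟩
  have hδ : 0 < ε / (2 * s) := by positivity
  have hsδ : s * (ε / (2 * s)) = ε / 2 := by field_simp
  constructor
  · filter_upwards [hbig, h1 _ hδ] with n ⟨hn0, hn⟩ hT
    rw [div_le_iff₀ hn0]
    have h3 := mul_le_mul_of_nonneg_left hT hs.le
    rw [← mul_assoc, mul_add, hsδ] at h3
    linarith [(abs_le.1 (hC n)).2]
  · refine ((h2 _ hδ).and_eventually hbig).mono ?_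
    rintro n ⟨hT, hn0, hn⟩
    rw [le_div_iff₀ hn0]
    have h3 := mul_le_mul_of_nonneg_left hT hs.le
    rw [← mul_assoc, mul_sub, hsδ] at h3
    linarith [(abs_le.1 (hC n)).1]

namespace IsBoundedStandardIID

variable {Ω : Type*} [MeasurableSpace Ω] {μ : Measure Ω} [IsProbabilityMeasure μ]
  {Z : ℕ → Ω → ℝ} {B : ℝ}

lemma ae_forall_lil_bounds (h : IsBoundedStandardIID μ Z B) :
    ∀ᵐ ω ∂μ, ∀ ε > 0,
      (∀ᶠ n : ℕ in atTop, ∑ i ∈ Finset.range n, Z i ω ≤ (1 + ε) * lilNorm n) ∧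
        ∃ᶠ n : ℕ in atTop, (1 - ε) * lilNorm n ≤ ∑ i ∈ Finset.range n, Z i ω := by
  have hpos (j : ℕ) : (0 : ℝ) < 1 / ((j + 1 : ℕ) + 1) := by positivity
  have hlt (j : ℕ) : (1 : ℝ) / ((j + 1 : ℕ) + 1) < 1 := by
    rw [div_lt_one (by positivity)]
    push_cast
    linarith [(Nat.cast_nonneg j : (0 : ℝ) ≤ j)]
  filter_upwards [ae_all_iff.2 fun j : ℕ => h.ae_eventually_sum_le (hpos j),
    ae_all_iff.2 fun j : ℕ => h.ae_frequently_le_sum (hpos j) (hlt j)] with ω h1 h2 ε hε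
  obtain ⟨j, hj⟩ := exists_nat_one_div_lt hε
  have hj' : (1 : ℝ) / ((j + 1 : ℕ) + 1) ≤ ε := by
    refine le_trans ?_ hj.le
    push_cast
    gcongr
    linarith
  refine ⟨(h1 j).mono fun n hn => hn.trans ?_, (h2 j).mono fun n hn => le_trans ?_ hn⟩
  · have := lilNorm_nonneg n
    gcongr
  · have := lilNorm_nonneg n
    gcongr

variable {W : ℕ → Ω → ℝ} {s C : ℝ}

lemma ae_limsup_eq (h : IsBoundedStandardIID μ Z B) (hs : 0 < s)
    (hW : ∀ᵐ ω ∂μ, ∀ n, |W n ω - s * ∑ i ∈ Finset.range n, Z i ω| ≤ C) :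
    ∀ᵐ ω ∂μ, limsup (fun n : ℕ => W n ω / lilNorm n) atTop = s ∧
      liminf (fun n : ℕ => W n ω / lilNorm n) atTop = -s := by
  filter_upwards [hW, h.ae_forall_lil_bounds, h.neg.ae_forall_lil_bounds] with ω hω h1 h2
  have hω' (n : ℕ) : |-W n ω - s * ∑ i ∈ Finset.range n, -Z i ω| ≤ C := by
    rw [Finset.sum_neg_distrib, mul_neg, ← neg_sub', abs_neg]
    exact hω n
  have hup {ε : ℝ} (hε : 0 < ε) := lil_bounds_of_abs_sub_le hs hω (fun ε hε => (h1 ε hε).1)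
    (fun ε hε => (h1 ε hε).2) hε
  have hlow {ε : ℝ} (hε : 0 < ε) := lil_bounds_of_abs_sub_le hs hω' (fun ε hε => (h2 ε hε).1)
    (fun ε hε => (h2 ε hε).2) hε
  refine ⟨limsup_eq_of_forall_pos (fun ε hε => (hup hε).1) fun ε hε => (hup hε).2,
    liminf_eq_of_forall_pos (fun ε hε => (hlow hε).1.mono fun n hn => ?_)
      fun ε hε => (hlow hε).2.mono fun n hn => ?_⟩
  · rw [neg_div] at hn; linarith
  · rw [neg_div] at hn; linarith

lemma ae_tendsto_div (h : IsBoundedStandardIID μ Z B)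
    (hW : ∀ᵐ ω ∂μ, ∀ n, |W n ω - s * ∑ i ∈ Finset.range n, Z i ω| ≤ C) :
    ∀ᵐ ω ∂μ, Tendsto (fun n : ℕ => W n ω / n) atTop (𝓝 0) := by
  filter_upwards [hW, strong_law_ae_real Z (h.integrable 0)
    (fun i j hij => h.indep.indepFun hij) h.ident] with ω hω hlim
  rw [h.mean] at hlim
  have herr : Tendsto (fun n : ℕ => (W n ω - s * ∑ i ∈ Finset.range n, Z i ω) / n) atTop (𝓝 0) := by
    refine squeeze_zero_norm (fun n => ?_) (tendsto_const_div_atTop_nhds_zero_nat C)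
    rw [norm_div, Real.norm_natCast]
    gcongr
    exact hω n
  have := herr.add (hlim.const_mul s)
  rw [mul_zero, add_zero] at this
  refine this.congr fun n => ?_
  ring

lemma tendsto_integral_div_sqrt (h : IsBoundedStandardIID μ Z B) (hWm : ∀ n, Measurable (W n))
    (hW : ∀ᵐ ω ∂μ, ∀ n, |W n ω - s * ∑ i ∈ Finset.range n, Z i ω| ≤ C)
    (g : BoundedContinuousFunction ℝ ℝ) :
    Tendsto (fun n : ℕ => ∫ ω, g (W n ω / √n) ∂μ) atTop
      (𝓝 (∫ x, g x ∂gaussianReal 0 (s ^ 2).toNNReal)) := by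
  have hclt := tendstoInDistribution_inv_sqrt_mul_sum (HasLaw.id (μ := gaussianReal 0 1))
    h.mean h.var h.indep h.ident
  have hscale := hclt.continuous_comp (continuous_const_mul s)
  have hslutsky := tendstoInDistribution_of_tendstoInMeasure_sub (fun (n : ℕ) ω => W n ω / √n) _
    hscale (tendstoInMeasure_of_tendsto_ae (fun n => ?_) ?_)
    (fun n => ((hWm n).div_const _).aemeasurable)
  · have := ProbabilityMeasure.tendsto_iff_forall_integral_tendsto.1 hslutsky.tendsto g
    simp only [ProbabilityMeasure.coe_mk] at this
    have hgauss : (gaussianReal 0 1).map ((fun x => s * x) ∘ id) =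
        gaussianReal 0 (s ^ 2).toNNReal := by
      rw [Function.comp_id, gaussianReal_map_const_mul]
      simp only [mul_zero, mul_one]
      congr 1
      ext
      simp [sq_nonneg]
    rw [hgauss] at this
    refine this.congr fun n => ?_
    rw [integral_map ((hWm n).div_const _).aemeasurable g.continuous.aestronglyMeasurable]
  · refine Measurable.aestronglyMeasurable ?_
    have := Finset.measurable_fun_sum (Finset.range n) fun i _ => h.meas i
    exact ((hWm n).div_const _).sub ((this.const_mul _).const_mul s)
  · filter_upwards [hW] with ω hω
    have hC : Tendsto (fun n : ℕ => C / √(n : ℝ)) atTop (𝓝 0) :=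
      (Real.tendsto_sqrt_atTop.comp tendsto_natCast_atTop_atTop).const_div_atTop C
    refine squeeze_zero_norm (fun n => ?_) hC
    have : (((fun (n : ℕ) ω => W n ω / √n) - fun (n : ℕ) => (fun x => s * x) ∘ fun ω =>
        (√(n : ℝ))⁻¹ * ∑ k ∈ Finset.range n, Z k ω) n ω) =
        (W n ω - s * ∑ i ∈ Finset.range n, Z i ω) / √n := by
      simp only [Pi.sub_apply, Function.comp_apply]
      ring
    rw [this, norm_div, Real.norm_of_nonneg (Real.sqrt_nonneg _)]
    gcongr
    exact hω n

end IsBoundedStandardIID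

/-- The law on `{-1, 1}` with mean `m`. -/
noncomputable def signLaw (m : ℝ) : Measure ℝ :=
  ENNReal.ofReal ((1 + m) / 2) • Measure.dirac 1 + ENNReal.ofReal ((1 - m) / 2) • Measure.dirac (-1)

lemma integral_signLaw {m : ℝ} (hm : |m| ≤ 1) (f : ℝ → ℝ) :
    ∫ x, f x ∂signLaw m = (1 + m) / 2 * f 1 + (1 - m) / 2 * f (-1) := by
  have h := abs_le.1 hm
  rw [signLaw, integral_add_measure, integral_smul_measure, integral_smul_measure, integral_dirac,
    integral_dirac, ENNReal.toReal_ofReal (by linarith), ENNReal.toReal_ofReal (by linarith)]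
  · simp
  · exact (integrable_dirac (by simp)).smul_measure ENNReal.ofReal_ne_top
  · exact (integrable_dirac (by simp)).smul_measure ENNReal.ofReal_ne_top

lemma measure_inter_preimage_eq_mul_signLaw {Ω : Type*} [MeasurableSpace Ω] {μ : Measure Ω}
    [IsFiniteMeasure μ] {Y : Ω → ℝ} (hY : Measurable Y) (hval : ∀ᵐ ω ∂μ, Y ω = 1 ∨ Y ω = -1)
    {D : Set Ω} {m : ℝ} (hm : |m| ≤ 1)
    (hint : ∫ ω in D, Y ω ∂μ = m * μ.real D) {s : Set ℝ} (hs : MeasurableSet s) :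
    μ (D ∩ Y ⁻¹' s) = μ D * signLaw m s := by
  have h := abs_le.1 hm
  have hplus : MeasurableSet (Y ⁻¹' {1}) := hY (measurableSet_singleton _)
  have hminus : MeasurableSet (Y ⁻¹' {-1}) := hY (measurableSet_singleton _)
  have hsum : μ.real (D ∩ Y ⁻¹' {1}) + μ.real (D ∩ Y ⁻¹' {-1}) = μ.real D := by
    rw [← measureReal_inter_add_sdiff (s := D) hplus]
    congr 1
    refine measureReal_congr ?_
    filter_upwards [hval] with ω hω
    refine propext ⟨fun ⟨h1, h2⟩ => ⟨h1, fun h3 => ?_⟩, fun ⟨h1, h2⟩ => ⟨h1, hω.resolve_left h2⟩⟩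
    have h2' : Y ω = -1 := h2
    have h3' : Y ω = 1 := h3
    linarith
  have hdiff : μ.real (D ∩ Y ⁻¹' {1}) - μ.real (D ∩ Y ⁻¹' {-1}) = m * μ.real D := by
    have he : ∫ ω in D, Y ω ∂μ = ∫ ω in D, ((Y ⁻¹' {1}).indicator 1 ω -
        (Y ⁻¹' {-1}).indicator 1 ω : ℝ) ∂μ := by
      refine integral_congr_ae (ae_restrict_of_ae ?_)
      filter_upwards [hval] with ω hω
      rcases hω with hω | hω <;> simp [Set.indicator, hω] <;> norm_num
    have hi {S : Set Ω} (hS : MeasurableSet S) :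
        Integrable (S.indicator (1 : Ω → ℝ)) (μ.restrict D) :=
      (integrable_const (1 : ℝ)).indicator hS
    rw [← hint, he, integral_sub (hi hplus) (hi hminus), integral_indicator_one hplus,
      integral_indicator_one hminus, measureReal_restrict_apply hplus,
      measureReal_restrict_apply hminus, Set.inter_comm, Set.inter_comm D]
  have hp : μ (D ∩ Y ⁻¹' {1}) = μ D * ENNReal.ofReal ((1 + m) / 2) := by
    rw [← ofReal_measureReal, ← ofReal_measureReal (s := D),
      ← ENNReal.ofReal_mul measureReal_nonneg]
    congr 1
    linarith
  have hn : μ (D ∩ Y ⁻¹' {-1}) = μ D * ENNReal.ofReal ((1 - m) / 2) := by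
    rw [← ofReal_measureReal, ← ofReal_measureReal (s := D),
      ← ENNReal.ofReal_mul measureReal_nonneg]
    congr 1
    linarith
  have hsplit : μ (D ∩ Y ⁻¹' s) =
      μ (D ∩ Y ⁻¹' {1} ∩ Y ⁻¹' s) + μ (D ∩ Y ⁻¹' {-1} ∩ Y ⁻¹' s) := by
    rw [← measure_inter_add_sdiff (D ∩ Y ⁻¹' s) hplus]
    congr 1
    · congr 1
      ext ω
      simp only [Set.mem_inter_iff]
      tauto
    · refine measure_congr ?_
      filter_upwards [hval] with ω hω
      refine propext ⟨fun ⟨⟨h1, h2⟩, h3⟩ => ⟨⟨h1, hω.resolve_left h3⟩, h2⟩,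
        fun ⟨⟨h1, h2⟩, h3⟩ => ⟨⟨h1, h3⟩, fun h4 => ?_⟩⟩
      have h2' : Y ω = -1 := h2
      have h4' : Y ω = 1 := h4
      linarith
  have hcase (c : ℝ) : μ (D ∩ Y ⁻¹' {c} ∩ Y ⁻¹' s) = μ (D ∩ Y ⁻¹' {c}) * Measure.dirac c s := by
    rw [Measure.dirac_apply' c hs, Set.inter_assoc, ← Set.preimage_inter]
    by_cases hc : c ∈ s <;> simp [hc]
  rw [hsplit, hcase, hcase, hp, hn, signLaw]
  simp only [Measure.coe_add, Measure.coe_smul, Pi.add_apply, Pi.smul_apply, smul_eq_mul]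
  ring

/-- Centred and normalised independent `±1`-valued variables with mean `m`. -/
lemma isBoundedStandardIID_of_map_eq_signLaw {Ω : Type*} [MeasurableSpace Ω] {μ : Measure Ω}
    {Y : ℕ → Ω → ℝ} (hY : ∀ n, Measurable (Y n)) (hind : iIndepFun Y μ) {m : ℝ} (hm : |m| < 1)
    (hlaw : ∀ n, μ.map (Y n) = signLaw m) :
    IsBoundedStandardIID μ (fun n ω => (Y n ω - m) / √(1 - m ^ 2)) (2 / √(1 - m ^ 2)) where
  meas n := ((hY n).sub_const m).div_const _
  indep := hind.comp (fun _ x => (x - m) / √(1 - m ^ 2)) fun _ => by fun_prop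
  ident n := by
    have : IdentDistrib (Y n) (Y 0) μ μ :=
      ⟨(hY n).aemeasurable, (hY 0).aemeasurable, by rw [hlaw, hlaw]⟩
    exact this.comp (u := fun x => (x - m) / √(1 - m ^ 2)) (by fun_prop)
  bdd := by
    have h : ∀ᵐ x ∂μ.map (Y 0), |(x - m) / √(1 - m ^ 2)| ≤ 2 / √(1 - m ^ 2) := by
      have hset : MeasurableSet {x : ℝ | |(x - m) / √(1 - m ^ 2)| ≤ 2 / √(1 - m ^ 2)} :=
        measurableSet_le (by fun_prop) (by fun_prop)
      have h1 := abs_lt.1 hm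
      have hle (x : ℝ) (hx : |x - m| ≤ 2) : |(x - m) / √(1 - m ^ 2)| ≤ 2 / √(1 - m ^ 2) := by
        rw [abs_div, abs_of_nonneg (Real.sqrt_nonneg _)]
        gcongr
      rw [hlaw, signLaw, ae_add_measure_iff]
      refine ⟨Measure.ae_smul_measure ?_ _, Measure.ae_smul_measure ?_ _⟩
      · exact (ae_dirac_iff hset).2 (hle 1 (abs_le.2 ⟨by linarith, by linarith⟩))
      · exact (ae_dirac_iff hset).2 (hle (-1) (abs_le.2 ⟨by linarith, by linarith⟩))
    exact ae_of_ae_map (hY 0).aemeasurable h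
  mean := by
    rw [← integral_map (f := fun x => (x - m) / √(1 - m ^ 2)) (hY 0).aemeasurable
      (by fun_prop), hlaw, integral_signLaw hm.le]
    ring
  var := by
    have hpos : 0 < 1 - m ^ 2 := by
      rw [sub_pos, sq_lt_one_iff_abs_lt_one]
      exact hm
    rw [← integral_map (f := fun x => ((x - m) / √(1 - m ^ 2)) ^ 2) (hY 0).aemeasurable
      (by fun_prop), hlaw, integral_signLaw hm.le, div_pow, div_pow, Real.sq_sqrt hpos.le]
    field_simp
    ring

/-- On a set where the conditional expectation is constant, the integral is a multiple of the
measure. -/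
lemma setIntegral_eq_mul_of_condExp_ae_eq {Ω : Type*} {m mΩ : MeasurableSpace Ω} {μ : Measure Ω}
    [IsFiniteMeasure μ] (hm : m ≤ mΩ) {Y f : Ω → ℝ} (hY : Integrable Y μ) (h : μ[Y | m] =ᵐ[μ] f)
    {D : Set Ω} (hD : MeasurableSet[m] D) {c : ℝ} (hc : ∀ ω ∈ D, f ω = c) :
    ∫ ω in D, Y ω ∂μ = c * μ.real D := by
  rw [← setIntegral_condExp hm hY hD, integral_congr_ae (ae_restrict_of_ae h),
    setIntegral_congr_fun (hm _ hD) hc]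
  simp [mul_comm]

section Walk

lemma measurable_sigmaUpTo {Ω : Type*} {X : ℕ → Ω → ℝ} {n i : ℕ} (h1 : 1 ≤ i) (hn : i ≤ n) :
    Measurable[sigmaUpTo X n] (X i) :=
  Measurable.mono (comap_measurable (X i))
    (le_iSup₂_of_le (f := fun i _ => MeasurableSpace.comap (X i) inferInstance) i
      (Finset.mem_Icc.2 ⟨h1, hn⟩) le_rfl) le_rfl

lemma partialSum_sub_sum_range {Ω : Type*} {X : ℕ → Ω → ℝ} (n : ℕ) (ω : Ω) :
    partialSum X n ω - ∑ i ∈ Finset.range n, X (i + 3) ω =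
      X 1 ω + X 2 ω - X (n + 1) ω - X (n + 2) ω := by
  induction n with
  | zero => simp [partialSum]
  | succ n ih =>
    simp only [partialSum] at ih ⊢
    rw [Finset.sum_Icc_succ_top (by omega), Finset.sum_range_succ]
    linarith

variable {Ω : Type*} [MeasurableSpace Ω] {μ : Measure Ω} {X : ℕ → Ω → ℝ}

lemma sigmaUpTo_le (hX : ∀ i, Measurable (X i)) (n : ℕ) :
    sigmaUpTo X n ≤ ‹MeasurableSpace Ω› :=
  iSup₂_le fun i _ => (hX i).comap_le

lemma ae_add_eq (hval : ∀ i, 1 ≤ i → ∀ᵐ ω ∂μ, X i ω = 1 ∨ X i ω = -1) :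
    ∀ᵐ ω ∂μ, (X 1 ω + X 2 ω = 2 ∨ X 1 ω + X 2 ω = -2) ∧ X 1 ω * X 2 ω = 1 ∨
      X 1 ω + X 2 ω = 0 ∧ X 1 ω * X 2 ω ≠ 1 := by
  filter_upwards [hval 1 le_rfl, hval 2 one_le_two] with ω h1 h2
  rcases h1 with h1 | h1 <;> rcases h2 with h2 | h2 <;> norm_num [h1, h2]

lemma integral_eq_add_add_setIntegral_add_eq (hX : ∀ i, Measurable (X i))
    (hval : ∀ i, 1 ≤ i → ∀ᵐ ω ∂μ, X i ω = 1 ∨ X i ω = -1) {f : Ω → ℝ} (hf : Integrable f μ) :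
    ∫ ω, f ω ∂μ = ∫ ω in {ω | X 1 ω + X 2 ω = 2}, f ω ∂μ +
      ∫ ω in {ω | X 1 ω + X 2 ω = -2}, f ω ∂μ + ∫ ω in {ω | X 1 ω + X 2 ω = 0}, f ω ∂μ := by
  have hA (v : ℝ) : MeasurableSet {ω | X 1 ω + X 2 ω = v} :=
    ((hX 1).add (hX 2)) (measurableSet_singleton v)
  have hdisj {v w : ℝ} (hvw : v ≠ w) :
      Disjoint {ω | X 1 ω + X 2 ω = v} {ω | X 1 ω + X 2 ω = w} :=
    Set.disjoint_left.2 fun ω h1 h2 => hvw (h1.symm.trans h2)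
  rw [← setIntegral_union (hdisj (by norm_num)) (hA _) hf.integrableOn hf.integrableOn,
    ← setIntegral_union ((hdisj (by norm_num)).union_left (hdisj (by norm_num))) (hA _)
      hf.integrableOn hf.integrableOn, ← setIntegral_univ]
  refine setIntegral_congr_set ?_
  filter_upwards [ae_add_eq hval] with ω hω
  refine propext ⟨fun _ => ?_, fun _ => trivial⟩
  rcases hω with ⟨h | h, _⟩ | ⟨h, _⟩
  · exact Or.inl (Or.inl h)
  · exact Or.inl (Or.inr h)
  · exact Or.inr h

lemma measurable_partialSum (hX : ∀ i, Measurable (X i)) (n : ℕ) :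
    Measurable (partialSum X n) :=
  Finset.measurable_fun_sum _ fun i _ => hX i

lemma measurable_centered_partialSum (hX : ∀ i, Measurable (X i)) (a : ℝ) (n : ℕ) :
    Measurable fun ω => partialSum X n ω - n * a * (X 1 ω + X 2 ω) / 2 :=
  (measurable_partialSum hX n).sub ((((hX 1).add (hX 2)).const_mul _).div_const 2)

lemma ae_cond_abs_sub_le (hX : ∀ i, Measurable (X i))
    (hval : ∀ i, 1 ≤ i → ∀ᵐ ω ∂μ, X i ω = 1 ∨ X i ω = -1) {a v : ℝ} (hm : |a * v / 2| < 1) :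
    ∀ᵐ ω ∂μ[|{ω | X 1 ω + X 2 ω = v}], ∀ n : ℕ,
      |partialSum X n ω - n * a * (X 1 ω + X 2 ω) / 2 - √(1 - (a * v / 2) ^ 2) *
        ∑ i ∈ Finset.range n, (X (i + 3) ω - a * v / 2) / √(1 - (a * v / 2) ^ 2)| ≤ 4 := by
  have hA : MeasurableSet {ω | X 1 ω + X 2 ω = v} :=
    ((hX 1).add (hX 2)) (measurableSet_singleton v)
  have hs : 0 < √(1 - (a * v / 2) ^ 2) := by
    rw [Real.sqrt_pos, sub_pos, sq_lt_one_iff_abs_lt_one]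
    exact hm
  have hbdd : ∀ᵐ ω ∂μ, ∀ i, 1 ≤ i → |X i ω| ≤ 1 := by
    refine ae_all_iff.2 fun i => ?_
    by_cases hi : 1 ≤ i
    · filter_upwards [hval i hi] with ω hω _
      rcases hω with hω | hω <;> simp [hω]
    · simp [hi]
  filter_upwards [ae_cond_mem hA, cond_absolutelyContinuous.ae_le hbdd] with ω hω hb n
  have hω' : X 1 ω + X 2 ω = v := hω
  have hsum : √(1 - (a * v / 2) ^ 2) *
      ∑ i ∈ Finset.range n, (X (i + 3) ω - a * v / 2) / √(1 - (a * v / 2) ^ 2) =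
      ∑ i ∈ Finset.range n, X (i + 3) ω - n * (a * v / 2) := by
    rw [← Finset.sum_div, mul_div_cancel₀ _ hs.ne', Finset.sum_sub_distrib]
    simp
  have h0 : partialSum X n ω - n * a * (X 1 ω + X 2 ω) / 2 -
      (∑ i ∈ Finset.range n, X (i + 3) ω - n * (a * v / 2)) =
      X 1 ω + X 2 ω - X (n + 1) ω - X (n + 2) ω := by
    rw [← partialSum_sub_sum_range, hω']
    ring
  rw [hsum, h0]
  have h1 := abs_le.1 (hb 1 le_rfl)
  have h2 := abs_le.1 (hb 2 one_le_two)
  have h3 := abs_le.1 (hb (n + 1) (by omega))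
  have h4 := abs_le.1 (hb (n + 2) (by omega))
  exact abs_le.2 ⟨by linarith, by linarith⟩

variable [IsProbabilityMeasure μ]

lemma integrable_step (hX : ∀ i, Measurable (X i))
    (hval : ∀ i, 1 ≤ i → ∀ᵐ ω ∂μ, X i ω = 1 ∨ X i ω = -1) {i : ℕ} (hi : 1 ≤ i) :
    Integrable (X i) μ := by
  refine Integrable.of_bound (hX i).aestronglyMeasurable 1 ?_
  filter_upwards [hval i hi] with ω hω
  rcases hω with hω | hω <;> simp [hω]

/-- Conditionally on the sum of the first two steps, the later steps are i.i.d. -/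
lemma isBoundedStandardIID_cond (hX : ∀ i, Measurable (X i))
    (hval : ∀ i, 1 ≤ i → ∀ᵐ ω ∂μ, X i ω = 1 ∨ X i ω = -1) {a v : ℝ}
    (hcond : ∀ n, 2 ≤ n →
      μ[X (n + 1) | sigmaUpTo X n] =ᵐ[μ] fun ω => a * (X 1 ω + X 2 ω) / 2)
    (hm : |a * v / 2| < 1) (hA : μ {ω | X 1 ω + X 2 ω = v} ≠ 0) :
    IsBoundedStandardIID (μ[|{ω | X 1 ω + X 2 ω = v}])
      (fun n ω => (X (n + 3) ω - a * v / 2) / √(1 - (a * v / 2) ^ 2))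
      (2 / √(1 - (a * v / 2) ^ 2)) := by
  set A := {ω | X 1 ω + X 2 ω = v} with hAdef
  have hAm (n : ℕ) (hn : 2 ≤ n) : MeasurableSet[sigmaUpTo X n] A :=
    ((measurable_sigmaUpTo le_rfl (by omega)).add (measurable_sigmaUpTo one_le_two hn))
      (measurableSet_singleton v)
  have hA' : MeasurableSet A := sigmaUpTo_le hX 2 _ (hAm 2 le_rfl)
  have : IsProbabilityMeasure (μ[|A]) := cond_isProbabilityMeasure hA
  obtain ⟨hind, hlaw⟩ := iIndepFun_and_map_eq_of_inter_preimage (μ := μ[|A])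
    (Y := fun n => X (n + 3)) (fun n => hX _) (signLaw (a * v / 2)) (fun n B s hB hs => by
      have hle : (⨆ i ∈ Set.Iio n, MeasurableSpace.comap (X (i + 3)) inferInstance) ≤
          sigmaUpTo X (n + 2) :=
        iSup₂_le fun i hi => (measurable_sigmaUpTo (by omega)
          (by have := Set.mem_Iio.1 hi; omega)).comap_le
      have hD : MeasurableSet[sigmaUpTo X (n + 2)] (A ∩ B) :=
        MeasurableSet.inter (hAm _ (by omega)) (hle _ hB)
      have hint := setIntegral_eq_mul_of_condExp_ae_eq (sigmaUpTo_le hX (n + 2))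
        (integrable_step hX hval (by omega)) (hcond (n + 2) (by omega)) hD
        (c := a * v / 2) (fun ω hω => by rw [show X 1 ω + X 2 ω = v from hω.1])
      rw [cond_apply hA', cond_apply hA', ← Set.inter_assoc,
        measure_inter_preimage_eq_mul_signLaw (hX _) (hval _ (by omega)) hm.le hint hs, mul_assoc])
  exact isBoundedStandardIID_of_map_eq_signLaw (fun n => hX _) hind hm hlaw

lemma ae_of_ae_cond {A : Set Ω} (hA : MeasurableSet A) {P : Ω → Prop}
    (h : μ A ≠ 0 → ∀ᵐ ω ∂μ[|A], P ω) : ∀ᵐ ω ∂μ, ω ∈ A → P ω := by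
  by_cases h0 : μ A = 0
  · filter_upwards [measure_eq_zero_iff_ae_notMem.1 h0] with ω hω hω'
    exact absurd hω' hω
  · rw [← ae_restrict_iff' hA]
    have := h h0
    rwa [ProbabilityTheory.cond, Measure.ae_ennreal_smul_measure_iff] at this
    exact ENNReal.inv_ne_zero.2 (measure_ne_top μ A)

lemma tendsto_setIntegral_of_cond {A : Set Ω} {f : ℕ → Ω → ℝ} {l : ℝ}
    (h : μ A ≠ 0 → Tendsto (fun n => ∫ ω, f n ω ∂μ[|A]) atTop (𝓝 l)) :
    Tendsto (fun n => ∫ ω in A, f n ω ∂μ) atTop (𝓝 (μ.real A * l)) := by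
  by_cases h0 : μ A = 0
  · simp [Measure.restrict_eq_zero.2 h0, Measure.real, h0]
  · refine ((h h0).const_mul (μ.real A)).congr fun n => ?_
    have : μ.real A ≠ 0 := (measureReal_ne_zero_iff).2 h0
    rw [ProbabilityTheory.cond, integral_smul_measure, ENNReal.toReal_inv, smul_eq_mul,
      ← mul_assoc]
    change μ.real A * (μ.real A)⁻¹ * _ = _
    rw [mul_inv_cancel₀ this, one_mul]

/-- The three limit theorems restricted to the event `X 1 + X 2 = v`. -/
lemma limit_theorems_on_add_eq (hX : ∀ i, Measurable (X i))
    (hval : ∀ i, 1 ≤ i → ∀ᵐ ω ∂μ, X i ω = 1 ∨ X i ω = -1) {a v : ℝ}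
    (hcond : ∀ n, 2 ≤ n →
      μ[X (n + 1) | sigmaUpTo X n] =ᵐ[μ] fun ω => a * (X 1 ω + X 2 ω) / 2)
    (hm : |a * v / 2| < 1) :
    (∀ g : BoundedContinuousFunction ℝ ℝ, Tendsto (fun n : ℕ => ∫ ω in {ω | X 1 ω + X 2 ω = v},
        g ((partialSum X n ω - n * a * (X 1 ω + X 2 ω) / 2) / √n) ∂μ) atTop
      (𝓝 (μ.real {ω | X 1 ω + X 2 ω = v} *
        ∫ x, g x ∂gaussianReal 0 (1 - (a * v / 2) ^ 2).toNNReal))) ∧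
    (∀ᵐ ω ∂μ, X 1 ω + X 2 ω = v → Tendsto (fun n : ℕ =>
      (partialSum X n ω - n * a * (X 1 ω + X 2 ω) / 2) / n) atTop (𝓝 0)) ∧
    (∀ᵐ ω ∂μ, X 1 ω + X 2 ω = v →
      limsup (fun n : ℕ => (partialSum X n ω - n * a * (X 1 ω + X 2 ω) / 2) /
        √(2 * n * Real.log (Real.log n))) atTop = √(1 - (a * v / 2) ^ 2) ∧
      liminf (fun n : ℕ => (partialSum X n ω - n * a * (X 1 ω + X 2 ω) / 2) /
        √(2 * n * Real.log (Real.log n))) atTop = -√(1 - (a * v / 2) ^ 2)) := by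
  have hA : MeasurableSet {ω | X 1 ω + X 2 ω = v} :=
    ((hX 1).add (hX 2)) (measurableSet_singleton v)
  have hpos : 0 < 1 - (a * v / 2) ^ 2 := by
    rw [sub_pos, sq_lt_one_iff_abs_lt_one]
    exact hm
  have hW := ae_cond_abs_sub_le (μ := μ) hX hval hm
  refine ⟨fun g => tendsto_setIntegral_of_cond fun h0 => ?_, ae_of_ae_cond hA fun h0 => ?_,
    ae_of_ae_cond hA fun h0 => ?_⟩ <;>
    have := cond_isProbabilityMeasure h0 <;>
    have hZ := isBoundedStandardIID_cond hX hval hcond hm h0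
  · have := hZ.tendsto_integral_div_sqrt (measurable_centered_partialSum hX a) hW g
    rwa [Real.sq_sqrt hpos.le] at this
  · exact hZ.ae_tendsto_div hW
  · exact hZ.ae_limsup_eq (Real.sqrt_pos.2 hpos) hW

/-- The second step agrees with the first one with probability `p`. -/
lemma measureReal_add_eq_two_add_measureReal_add_eq_neg_two (hX : ∀ i, Measurable (X i))
    (hval : ∀ i, 1 ≤ i → ∀ᵐ ω ∂μ, X i ω = 1 ∨ X i ω = -1) {p : ℝ} (hp0 : 0 < p) (hp1 : p < 1)
    (hcond1 : μ[X 2 | sigmaUpTo X 1] =ᵐ[μ] fun ω => (2 * p - 1) * X 1 ω) :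
    μ.real {ω | X 1 ω + X 2 ω = 2} + μ.real {ω | X 1 ω + X 2 ω = -2} = p := by
  have hp : |2 * p - 1| ≤ 1 := abs_le.2 ⟨by linarith, by linarith⟩
  have hset (c : ℝ) : MeasurableSet[sigmaUpTo X 1] (X 1 ⁻¹' {c}) :=
    measurable_sigmaUpTo le_rfl le_rfl (measurableSet_singleton c)
  have hmass (c : ℝ) (hc : c = 1 ∨ c = -1) :
      μ.real {ω | X 1 ω + X 2 ω = 2 * c} = p * μ.real (X 1 ⁻¹' {c}) := by
    have hint := setIntegral_eq_mul_of_condExp_ae_eq (sigmaUpTo_le hX 1)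
      (integrable_step hX hval one_le_two) hcond1 (hset c) (c := (2 * p - 1) * c)
      (fun ω hω => by rw [show X 1 ω = c from hω])
    have hlaw : μ (X 1 ⁻¹' {c} ∩ X 2 ⁻¹' {c}) =
        μ (X 1 ⁻¹' {c}) * signLaw ((2 * p - 1) * c) {c} :=
      measure_inter_preimage_eq_mul_signLaw (hX 2) (hval 2 one_le_two)
        (by rcases hc with rfl | rfl <;> simpa only [abs_mul, abs_neg, abs_one, mul_one] using hp) hint (measurableSet_singleton c)
    have hκ : signLaw ((2 * p - 1) * c) {c} = ENNReal.ofReal p := by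
      rcases hc with rfl | rfl
      · norm_num [signLaw, Set.indicator]
      · norm_num [signLaw, Set.indicator]
    have hae : μ.real {ω | X 1 ω + X 2 ω = 2 * c} = μ.real (X 1 ⁻¹' {c} ∩ X 2 ⁻¹' {c}) := by
      refine measureReal_congr ?_
      filter_upwards [hval 1 le_rfl, hval 2 one_le_two] with ω h1 h2
      change (X 1 ω + X 2 ω = 2 * c) = (X 1 ω = c ∧ X 2 ω = c)
      rcases h1 with h1 | h1 <;> rcases h2 with h2 | h2 <;> rcases hc with rfl | rfl <;>
        norm_num [h1, h2]
    rw [hae, Measure.real, hlaw, hκ, ENNReal.toReal_mul, ENNReal.toReal_ofReal hp0.le, mul_comm]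
    rfl
  have htot : μ.real (X 1 ⁻¹' {1}) + μ.real (X 1 ⁻¹' {-1}) = 1 := by
    have hcompl : μ.real (X 1 ⁻¹' {-1}) = μ.real (X 1 ⁻¹' {1})ᶜ := by
      refine measureReal_congr ?_
      filter_upwards [hval 1 le_rfl] with ω h1
      change (X 1 ω = -1) = ¬ (X 1 ω = 1)
      rcases h1 with h1 | h1 <;> norm_num [h1]
    rw [hcompl, probReal_compl_eq_one_sub (hX 1 (measurableSet_singleton 1))]
    ring
  have h1 := hmass 1 (Or.inl rfl)
  have h2 := hmass (-1) (Or.inr rfl)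
  norm_num at h1 h2
  rw [h1, h2, ← mul_add, htot, mul_one]

end Walk

/-- for the elephant random walk remembering only the first two steps:
(a) `(Sₙ - n(2p-1)(X₁+X₂)/2)/√n` converges in distribution to the mixture
`p·N(0,4p(1-p)) + (1-p)·N(0,1)`; (b) `(Sₙ - n(2p-1)(X₁+X₂)/2)/n → 0` a.s.;
(c) the LIL: the limsup (resp. liminf) of `(Sₙ - n(2p-1)(X₁+X₂)/2)/√(2n log log n)` equals
`σ(X₁,X₂)` (resp. `-σ(X₁,X₂)`) a.s., where `σ(X₁,X₂) = 2√(p(1-p))` on `{X₁X₂ = 1}` and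
`σ(X₁,X₂) = 1` otherwise. -/
theorem elephant_first_two_steps_clt
    {Ω : Type*} [MeasurableSpace Ω] (μ : Measure Ω) [IsProbabilityMeasure μ]
    (p : ℝ) (hp0 : 0 < p) (hp1 : p < 1)
    (X : ℕ → Ω → ℝ)
    (hXmeas : ∀ i, Measurable (X i))
    (hval : ∀ i, 1 ≤ i → ∀ᵐ ω ∂μ, X i ω = 1 ∨ X i ω = -1)
    (hinit : μ {ω | X 1 ω = 1} = ENNReal.ofReal p)
    (hcond1 : μ[X 2 | sigmaUpTo X 1] =ᵐ[μ] fun ω => (2*p-1) * X 1 ω)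
    (hcond : ∀ n, 2 ≤ n →
      μ[X (n+1) | sigmaUpTo X n] =ᵐ[μ] fun ω => (2*p-1) * (X 1 ω + X 2 ω) / 2) :
    TendstoInDistribution μ
      (fun n ω => (partialSum X n ω - n*(2*p-1)*(X 1 ω + X 2 ω)/2) / Real.sqrt n)
      (ENNReal.ofReal p • gaussianReal 0 (Real.toNNReal (4*p*(1-p))) +
        ENNReal.ofReal (1-p) • gaussianReal 0 1) ∧
    (∀ᵐ ω ∂μ, Tendsto
      (fun n : ℕ => (partialSum X n ω - n*(2*p-1)*(X 1 ω + X 2 ω)/2) / n) atTop (𝓝 0)) ∧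
    (∀ᵐ ω ∂μ,
      limsup (fun n : ℕ =>
        (partialSum X n ω - n*(2*p-1)*(X 1 ω + X 2 ω)/2) /
          Real.sqrt (2*n*Real.log (Real.log n))) atTop =
        (if X 1 ω * X 2 ω = 1 then 2*Real.sqrt (p*(1-p)) else 1) ∧
      liminf (fun n : ℕ =>
        (partialSum X n ω - n*(2*p-1)*(X 1 ω + X 2 ω)/2) /
          Real.sqrt (2*n*Real.log (Real.log n))) atTop =
        -(if X 1 ω * X 2 ω = 1 then 2*Real.sqrt (p*(1-p)) else 1)) := by
  have hq (v : ℝ) (hv : v = 2 ∨ v = -2 ∨ v = 0) : |(2 * p - 1) * v / 2| < 1 := by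
    rcases hv with rfl | rfl | rfl <;> exact abs_lt.2 ⟨by linarith, by linarith⟩
  obtain ⟨a2, b2, c2⟩ := limit_theorems_on_add_eq hXmeas hval hcond (hq 2 (by simp))
  obtain ⟨an2, bn2, cn2⟩ := limit_theorems_on_add_eq hXmeas hval hcond (hq (-2) (by simp))
  obtain ⟨a0, b0, c0⟩ := limit_theorems_on_add_eq hXmeas hval hcond (hq 0 (by simp))
  have e2 : 1 - ((2 * p - 1) * 2 / 2) ^ 2 = 4 * p * (1 - p) := by ring
  have en2 : 1 - ((2 * p - 1) * (-2) / 2) ^ 2 = 4 * p * (1 - p) := by ring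
  have e0 : 1 - ((2 * p - 1) * 0 / 2) ^ 2 = 1 := by ring
  have hsqrt : √(4 * p * (1 - p)) = 2 * √(p * (1 - p)) := by
    rw [show 4 * p * (1 - p) = 2 ^ 2 * (p * (1 - p)) by ring, Real.sqrt_mul (by norm_num),
      Real.sqrt_sq (by norm_num)]
  rw [e2] at a2 c2
  rw [en2] at an2 cn2
  rw [e0] at a0 c0
  rw [hsqrt] at c2 cn2
  rw [Real.sqrt_one] at c0
  refine ⟨fun g => ?_, ?_, ?_⟩
  · have hint (n : ℕ) : Integrable (fun ω =>
        g ((partialSum X n ω - n * (2 * p - 1) * (X 1 ω + X 2 ω) / 2) / √n)) μ :=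
      Integrable.of_bound (g.continuous.measurable.comp
        ((measurable_centered_partialSum hXmeas _ n).div_const _)).aestronglyMeasurable ‖g‖
        (ae_of_all _ fun ω => g.norm_coe_le_norm _)
    have hmass := measureReal_add_eq_two_add_measureReal_add_eq_neg_two hXmeas hval hp0 hp1 hcond1
    have hmass0 : μ.real {ω | X 1 ω + X 2 ω = 0} = 1 - p := by
      have := integral_eq_add_add_setIntegral_add_eq hXmeas hval (integrable_const (μ := μ) (1 : ℝ))
      simp only [integral_const, smul_eq_mul, mul_one, probReal_univ,
        measureReal_restrict_apply_univ] at this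
      linarith
    have hlim := ((a2 g).add (an2 g)).add (a0 g)
    rw [← add_mul, hmass, hmass0, Real.toNNReal_one] at hlim
    rw [integral_add_measure ((g.integrable _).smul_measure ENNReal.ofReal_ne_top)
      ((g.integrable _).smul_measure ENNReal.ofReal_ne_top), integral_smul_measure,
      integral_smul_measure, ENNReal.toReal_ofReal hp0.le, ENNReal.toReal_ofReal (by linarith)]
    exact hlim.congr fun n => (integral_eq_add_add_setIntegral_add_eq hXmeas hval (hint n)).symm
  · filter_upwards [ae_add_eq hval, b2, bn2, b0] with ω hω h2 hn2 h0
    rcases hω with ⟨h | h, _⟩ | ⟨h, _⟩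
    exacts [h2 h, hn2 h, h0 h]
  · filter_upwards [ae_add_eq hval, c2, cn2, c0] with ω hω h2 hn2 h0
    rcases hω with ⟨h | h, h'⟩ | ⟨h, h'⟩
    · rw [if_pos h']; exact h2 h
    · rw [if_pos h']; exact hn2 h
    · rw [if_neg h']; exact h0 h
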